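/- Let q > 3 be a power of an odd prime, let m > 2 be an integer, n = (q^m−1)/2, and let a be an integer with 1 ≤ a < (q−1)/2. Set δ̃ = a(q^m−1)/(q−1) and δ = ⌈(δ̃+1)/2⌉. Then the negacyclic BCH code C_{(n,−1,δ,0)} over F_q has length n, minimum distance at least δ, and dimension k = Σ_{j=0}^{⌊(m−1)/2⌋} binom(m, 2j+1) · ⌈(q−a−1)/2⌉^{2j+1} · ⌊(q−a+1)/2⌋^{m−2j−1}; equivalently, n − |∪_{i=0}^{δ−2} C_{1+2i}^{2n}| = k. -/

import Mathlib

open Finset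

/-- The `q`-cyclotomic coset of `i` modulo `N`, as a subset of `ZMod N`. -/
def qCoset (q N i : ℕ) : Set (ZMod N) :=
  Set.range fun j : ℕ => (i : ZMod N) * (q : ZMod N) ^ j

/-- The odd `q`-cyclotomic coset leaders modulo `N`. -/
noncomputable def oddLeaders (q N : ℕ) : Finset ℕ := by
  classical
  exact (Finset.range N).filter fun s => Odd s ∧ ∀ j : ℕ, s ≤ (s * q ^ j) % N

/-- `x` is the `i`-th largest element of the finite set `S` (1-indexed). -/
def IsIthLargest (S : Finset ℕ) (i x : ℕ) : Prop :=
  x ∈ S ∧ (S.filter fun y => x ≤ y).card = i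

/-- Evaluation of the polynomial with coefficient vector `c` at the point `x`
of an extension field. -/
noncomputable def evalAt (F : Type*) {E : Type*} [Field F] [Field E] [Algebra F E]
    (n : ℕ) (x : E) : (Fin n → F) →ₗ[F] E where
  toFun c := ∑ j : Fin n, c j • x ^ (j : ℕ)
  map_add' a b := by simp [add_smul, Finset.sum_add_distrib]
  map_smul' r a := by simp [Finset.smul_sum, smul_smul]

/-- The negacyclic BCH code `C_(n,-1,δ,b)`: all words whose polynomial vanishes at
`γ^(1+2i)` for `b ≤ i ≤ b+δ-2`, where `γ` is a primitive `2n`-th root of unity. -/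
noncomputable def negaBCH (F : Type*) {E : Type*} [Field F] [Field E] [Algebra F E]
    (n : ℕ) (γ : E) (δ b : ℕ) : Submodule F (Fin n → F) :=
  ⨅ i ∈ Finset.Icc b (b + δ - 2), LinearMap.ker (evalAt F n (γ ^ (1 + 2 * i)))

/-- The cyclic BCH code `C_(n,1,δ,b)`: all words whose polynomial vanishes at
`β^i` for `b ≤ i ≤ b+δ-2`, where `β` is a primitive `n`-th root of unity. -/
noncomputable def cyclicBCH (F : Type*) {E : Type*} [Field F] [Field E] [Algebra F E]
    (n : ℕ) (β : E) (δ b : ℕ) : Submodule F (Fin n → F) :=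
  ⨅ i ∈ Finset.Icc b (b + δ - 2), LinearMap.ker (evalAt F n (β ^ i))

/-- The dual code under the standard inner product. -/
def dualCode {F : Type*} [Field F] {n : ℕ} (C : Submodule F (Fin n → F)) :
    Submodule F (Fin n → F) where
  carrier := {y | ∀ c ∈ C, ∑ j, y j * c j = 0}
  add_mem' := by
    intro a b ha hb c hc
    simp only [Set.mem_setOf_eq] at *
    simp [Pi.add_apply, add_mul, Finset.sum_add_distrib, ha c hc, hb c hc]
  zero_mem' := by intro c hc; simp
  smul_mem' := by
    intro r y hy c hc
    simp only [Set.mem_setOf_eq] at *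
    simp [Pi.smul_apply, smul_eq_mul, mul_assoc, ← Finset.mul_sum, hy c hc]

/-- The extended code of a code of length `n`. -/
def extendedCode {F : Type*} [Field F] {n : ℕ} (C : Submodule F (Fin n → F)) :
    Submodule F (Fin (n + 1) → F) where
  carrier := {x | (fun j : Fin n => x j.castSucc) ∈ C ∧ ∑ i, x i = 0}
  add_mem' := by
    intro a b ha hb
    exact ⟨C.add_mem ha.1 hb.1, by simp [Finset.sum_add_distrib, ha.2, hb.2]⟩
  zero_mem' := ⟨C.zero_mem, by simp⟩
  smul_mem' := by
    intro r x hx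
    exact ⟨C.smul_mem r hx.1, by simp [← Finset.mul_sum, hx.2]⟩

/-- Hamming weight of a word. -/
noncomputable def hWt {F : Type*} [Field F] {n : ℕ} (c : Fin n → F) : ℕ := by
  classical exact hammingNorm c

/-- `d` is the minimum Hamming distance of the code `C`. -/
def minDistIs {F : Type*} [Field F] {n : ℕ} (C : Submodule F (Fin n → F)) (d : ℕ) : Prop :=
  IsLeast {w : ℕ | ∃ c ∈ C, c ≠ 0 ∧ hWt c = w} d

section Codes

open Polynomial

variable {F E : Type*} [Field F] [Field E] [Algebra F E]

theorem evalAt_apply (n : ℕ) (x : E) (c : Fin n → F) :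
    evalAt F n x c = ∑ j : Fin n, c j • x ^ (j : ℕ) := rfl

theorem evalAt_coeff {n : ℕ} {p : F[X]} (hp : p ∈ degreeLT F n) (x : E) :
    evalAt F n x (fun j => p.coeff j) = aeval x p := by
  rw [evalAt_apply, Fin.sum_univ_eq_sum_range (fun j => p.coeff j • x ^ j) n]
  rcases eq_or_ne p 0 with rfl | h0
  · simp
  · rw [aeval_eq_sum_range' ((natDegree_lt_iff_degree_lt h0).2 (mem_degreeLT.1 hp))]

/-- The BCH bound. -/
theorem lt_hWt_of_evalAt_eq_zero {n d : ℕ} {γ : E} (hγ : IsPrimitiveRoot γ (2 * n))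
    {c : Fin n → F} (hc : c ≠ 0) (h : ∀ i < d, evalAt F n (γ ^ (1 + 2 * i)) c = 0) :
    d < hWt c := by
  classical
  by_contra! hle
  set s : Finset (Fin n) := univ.filter fun i => c i ≠ 0 with hs
  have hw : hWt c = s.card := by
    simp only [hWt, hammingNorm, hs]
  rw [hw] at hle
  have e := s.equivFin.symm
  have hn : n ≠ 0 := by
    rintro rfl
    exact hc (Subsingleton.elim _ _)
  have hγ0 : γ ≠ 0 := hγ.ne_zero (by omega)
  have hinj : Function.Injective fun k => γ ^ (2 * ((e k : Fin n) : ℕ)) := by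
    intro k l hkl
    have := hγ.pow_inj (by have := (e k : Fin n).2; omega) (by have := (e l : Fin n).2; omega) hkl
    exact e.injective (Subtype.ext (Fin.ext (by omega)))
  have hv := Matrix.eq_zero_of_forall_pow_sum_mul_pow_eq_zero hinj
    (v := fun k => c (e k) • γ ^ ((e k : Fin n) : ℕ)) (by
      intro i
      rw [e.sum_comp fun j : s => c j • γ ^ ((j : Fin n) : ℕ) * (γ ^ (2 * ((j : Fin n) : ℕ))) ^ (i : ℕ),
        Finset.sum_coe_sort s fun j => c j • γ ^ (j : ℕ) * (γ ^ (2 * (j : ℕ))) ^ (i : ℕ),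
        ← h i (i.2.trans_le hle), evalAt_apply]
      simp only [hs, Finset.sum_filter]
      refine Finset.sum_congr rfl fun j _ => ?_
      split_ifs with hj
      · rw [smul_mul_assoc, ← pow_mul, ← pow_mul, ← pow_add]
        congr 2
        ring
      · simp [not_not.1 hj])
  apply hc
  funext i
  by_contra hi
  have := congrFun hv (e.symm ⟨i, by simpa [hs] using hi⟩)
  simp [hγ0] at this
  exact hi this

variable [Fintype F]

theorem mem_range_algebraMap_of_pow_card_eq {x : E} (hx : x ^ Fintype.card F = x) :
    x ∈ Set.range (algebraMap F E) := by
  have hdeg := FiniteField.X_pow_card_sub_X_natDegree_eq F (Fintype.one_lt_card (α := F))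
  have hsplit := prod_multiset_X_sub_C_of_monic_of_roots_card_eq
    (monic_X_pow_sub (n := Fintype.card F) (p := (X : F[X]))
      (by simpa using Fintype.one_lt_card (α := F)))
    (by rw [FiniteField.roots_X_pow_card_sub_X, hdeg]; rfl)
  rw [FiniteField.roots_X_pow_card_sub_X] at hsplit
  have h := congrArg (aeval x) hsplit
  change aeval x (∏ a : F, (X - C a)) = _ at h
  rw [map_prod] at h
  simp only [map_sub, map_pow, aeval_X, aeval_C, hx, sub_self] at h
  obtain ⟨a, -, ha⟩ := Finset.prod_eq_zero_iff.1 h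
  exact ⟨a, (sub_eq_zero.1 ha).symm⟩

/-- A finite set of elements that is stable under the Frobenius map is the root set of a
monic polynomial over the base field. -/
theorem exists_monic_map_eq_prod_X_sub_C {R : Finset E}
    (hR : ∀ x ∈ R, x ^ Fintype.card F ∈ R) :
    ∃ g : F[X], g.map (algebraMap F E) = ∏ x ∈ R, (X - C x) ∧ g.natDegree = R.card ∧ g.Monic := by
  classical
  set φ := FiniteField.frobeniusAlgHom F E with hφ
  have hφa : ∀ x, φ x = x ^ Fintype.card F := fun x => by
    simp [hφ]
  have himg : R.image φ = R := Finset.eq_of_subset_of_card_le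
    (Finset.image_subset_iff.2 fun x hx => by simpa [hφa] using hR x hx)
    (Finset.card_image_of_injective R φ.toRingHom.injective).ge
  have hmap : (∏ x ∈ R, (X - C x)).map φ.toRingHom = ∏ x ∈ R, (X - C x) := by
    rw [Polynomial.map_prod]
    conv_rhs => rw [← himg, Finset.prod_image (f := fun x => X - C x) (g := φ) φ.toRingHom.injective.injOn]
    simp
  have hlift : (∏ x ∈ R, (X - C x)) ∈ lifts (algebraMap F E) := by
    rw [lifts_iff_coeff_lifts]
    intro k
    apply mem_range_algebraMap_of_pow_card_eq
    rw [← hφa]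
    conv_rhs => rw [← hmap]
    rw [coeff_map]
    rfl
  obtain ⟨g, h1, h2, h3⟩ := lifts_and_natDegree_eq_and_monic hlift
    (monic_prod_of_monic _ _ fun x _ => monic_X_sub_C x)
  refine ⟨g, h1, h2.trans ?_, h3⟩
  rw [natDegree_prod_of_monic _ _ fun x _ => monic_X_sub_C x]
  simp

theorem finrank_iInf_ker_evalAt {ι : Type*} (n : ℕ) (A : Finset ι) (y : ι → E) (R : Finset E)
    (hA : ∀ i ∈ A, y i ∈ R) (hR : ∀ x ∈ R, x ^ Fintype.card F ∈ R)
    (hRA : ∀ x ∈ R, ∃ i ∈ A, ∃ j : ℕ, x = y i ^ Fintype.card F ^ j) :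
    Module.finrank F (⨅ i ∈ A, LinearMap.ker (evalAt F n (y i)) : Submodule F (Fin n → F)) =
      n - R.card := by
  classical
  obtain ⟨g, hg, hdeg, hmon⟩ := exists_monic_map_eq_prod_X_sub_C hR
  have hroot : ∀ f : F[X], (∀ i ∈ A, aeval (y i) f = 0) ↔ g ∣ f := by
    intro f
    constructor
    · intro h
      rw [← map_dvd_map' (algebraMap F E), hg]
      refine Finset.prod_dvd_of_coprime
        (fun a _ b _ hab => pairwise_coprime_X_sub_C Function.injective_id hab) fun x hx => ?_
      obtain ⟨i, hi, j, rfl⟩ := hRA x hx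
      rw [dvd_iff_isRoot, IsRoot.def, eval_map_algebraMap]
      induction j with
      | zero => simpa using h i hi
      | succ j ih =>
        have hR' : y i ^ Fintype.card F ^ j ∈ R := by
          clear ih hx
          induction j with
          | zero => simpa using hA i hi
          | succ j ih => rw [pow_succ, pow_mul]; exact hR _ ih
        have := ih hR'
        have h2 := aeval_algHom_apply (FiniteField.frobeniusAlgHom F E) (y i ^ Fintype.card F ^ j) f
        rw [this, map_zero, FiniteField.coe_frobeniusAlgHom] at h2
        rw [pow_succ, pow_mul]
        exact h2
    · rintro ⟨p, rfl⟩ i hi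
      have : aeval (y i) g = 0 := by
        rw [← eval_map_algebraMap, hg, eval_prod]
        exact Finset.prod_eq_zero (hA i hi) (by simp)
      simp [this]
  have hdegmul : ∀ p : F[X], g * p ∈ degreeLT F n ↔ p ∈ degreeLT F (n - R.card) := by
    intro p
    rcases eq_or_ne p 0 with rfl | hp
    · simp
    have hgp : g * p ≠ 0 := mul_ne_zero hmon.ne_zero hp
    rw [mem_degreeLT, mem_degreeLT, ← natDegree_lt_iff_degree_lt hgp,
      ← natDegree_lt_iff_degree_lt hp, hmon.natDegree_mul' hp, hdeg]
    omega
  let ψ : degreeLT F (n - R.card) →ₗ[F] (Fin n → F) :=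
    { toFun := fun p j => (g * (p : F[X])).coeff j
      map_add' := fun p q => by ext; simp [mul_add]
      map_smul' := fun r p => by ext; simp }
  have hψ : Function.Injective ψ := by
    rw [← LinearMap.ker_eq_bot, LinearMap.ker_eq_bot']
    intro p hp
    have h := (degreeLTEquiv_eq_zero_iff_eq_zero ((hdegmul p).2 p.2)).1 hp
    exact Subtype.ext ((mul_eq_zero.1 h).resolve_left hmon.ne_zero)
  have hrange : LinearMap.range ψ = ⨅ i ∈ A, LinearMap.ker (evalAt F n (y i)) := by
    ext c
    simp only [Submodule.mem_iInf, LinearMap.mem_ker, LinearMap.mem_range]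
    constructor
    · rintro ⟨p, rfl⟩ i hi
      exact (evalAt_coeff ((hdegmul p).2 p.2) _).trans ((hroot _).2 (dvd_mul_right g p) i hi)
    · intro h
      obtain ⟨f, rfl⟩ := (degreeLTEquiv F n).surjective c
      have : g ∣ (f : F[X]) := (hroot _).1 fun i hi => (evalAt_coeff f.2 _).symm.trans (h i hi)
      obtain ⟨p, hp⟩ := this
      refine ⟨⟨p, (hdegmul p).1 (hp ▸ f.2)⟩, ?_⟩
      funext j
      change (g * p).coeff j = (f : F[X]).coeff j
      rw [hp]
  rw [← hrange, LinearMap.finrank_range_of_inj hψ, (degreeLTEquiv F _).finrank_eq]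
  simp

end Codes

section Digits

variable {m q : ℕ}

theorem odd_finFunctionFinEquiv (hq : Odd q) (f : Fin m → Fin q) :
    Odd (finFunctionFinEquiv f : ℕ) ↔ Odd (∑ i, (f i : ℕ)) := by
  rw [finFunctionFinEquiv_apply, ← ZMod.natCast_eq_one_iff_odd, ← ZMod.natCast_eq_one_iff_odd]
  simp [(ZMod.natCast_eq_one_iff_odd).2 hq]

theorem natCast_finFunctionFinEquiv_sub [NeZero m] {N : ℕ} (hN : (q : ZMod N) ^ m = 1)
    (f : Fin m → Fin q) (j : Fin m) :
    ((finFunctionFinEquiv fun i => f (i - j) : Fin (q ^ m)) : ZMod N) =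
      (finFunctionFinEquiv f : ℕ) * (q : ZMod N) ^ (j : ℕ) := by
  rw [finFunctionFinEquiv_apply, finFunctionFinEquiv_apply, ← Equiv.sum_comp (Equiv.addRight j)]
  push_cast
  rw [Finset.sum_mul]
  refine Finset.sum_congr rfl fun i _ => ?_
  rw [mul_assoc, ← pow_add]
  simp only [Equiv.coe_addRight, add_sub_cancel_right, Fin.val_add]
  rw [← pow_eq_pow_mod _ hN]

theorem le_finFunctionFinEquiv {a : ℕ} {f : Fin m → Fin q} (h : ∀ i, a ≤ f i) :
    a * ∑ i ∈ range m, q ^ i ≤ (finFunctionFinEquiv f : ℕ) := by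
  rw [finFunctionFinEquiv_apply, ← Fin.sum_univ_eq_sum_range (fun i => q ^ i) m, Finset.mul_sum]
  exact Finset.sum_le_sum fun i _ => Nat.mul_le_mul_right _ (h i)

theorem finFunctionFinEquiv_lt {a : ℕ} {f : Fin m → Fin q} {i : Fin m} (hi : (i : ℕ) + 1 = m)
    (h : (f i : ℕ) < a) : (finFunctionFinEquiv f : ℕ) < a * ∑ i ∈ range m, q ^ i := by
  have hq : 0 < q := (Nat.zero_le _).trans_lt (f i).2
  have hle : a * q ^ (i : ℕ) ≤ a * ∑ i ∈ range m, q ^ i :=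
    Nat.mul_le_mul_left _ (Finset.single_le_sum (f := fun i => q ^ i) (fun _ _ => Nat.zero_le _)
      (Finset.mem_range.2 i.2))
  refine lt_of_lt_of_le ?_ hle
  by_contra! hge
  have h1 : a ≤ (finFunctionFinEquiv f : ℕ) / q ^ (i : ℕ) :=
    (Nat.le_div_iff_mul_le (pow_pos hq _)).2 hge
  have h2 : (finFunctionFinEquiv f : ℕ) / q ^ (i : ℕ) < q := by
    rw [Nat.div_lt_iff_lt_mul (pow_pos hq _), ← pow_succ', hi]
    exact (finFunctionFinEquiv f).2
  have h3 : ((finFunctionFinEquiv.symm (finFunctionFinEquiv f)) i : ℕ) =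
      (finFunctionFinEquiv f : ℕ) / q ^ (i : ℕ) % q := rfl
  rw [Equiv.symm_apply_apply, Nat.mod_eq_of_lt h2] at h3
  omega

theorem two_mul_card_odd_sum_piFinset (S : Finset (Fin q)) :
    2 * (((Fintype.piFinset fun _ : Fin m => S).filter fun f => Odd (∑ i, (f i : ℕ))).card : ℤ) =
      (S.card : ℤ) ^ m - (∑ d ∈ S, (-1) ^ (d : ℕ)) ^ m := by
  have h : (∑ d ∈ S, (-1 : ℤ) ^ (d : ℕ)) ^ m =
      ∑ f ∈ Fintype.piFinset fun _ : Fin m => S, (-1) ^ (∑ i, (f i : ℕ)) := by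
    simp_rw [← Finset.prod_pow_eq_pow_sum]
    rw [← Finset.prod_univ_sum (fun _ : Fin m => S) (fun _ d => (-1 : ℤ) ^ (d : ℕ))]
    simp
  have h1 : (S.card : ℤ) ^ m = ∑ f ∈ Fintype.piFinset fun _ : Fin m => S, (1 : ℤ) := by
    simp
  rw [h, h1, ← Finset.sum_sub_distrib, Finset.card_filter, Nat.cast_sum, Finset.mul_sum]
  refine Finset.sum_congr rfl fun f _ => ?_
  split_ifs with ho
  · rw [ho.neg_one_pow]; norm_num
  · rw [(Nat.not_odd_iff_even.1 ho).neg_one_pow]; norm_num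

theorem two_mul_sum_choose_odd (m x y : ℕ) :
    2 * ((∑ j ∈ range ((m - 1) / 2 + 1),
      m.choose (2 * j + 1) * x ^ (2 * j + 1) * y ^ (m - 2 * j - 1) : ℕ) : ℤ) =
      ((x + y : ℕ) : ℤ) ^ m - ((y : ℤ) - x) ^ m := by
  rcases Nat.eq_zero_or_pos m with rfl | hm
  · simp
  set g : ℕ → ℤ := fun t => m.choose t * x ^ t * y ^ (m - t) with hg
  have h1 : ((x + y : ℕ) : ℤ) ^ m - ((y : ℤ) - x) ^ m =
      ∑ t ∈ range (m + 1), (1 - (-1) ^ t) * g t := by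
    rw [sub_eq_neg_add (y : ℤ), Nat.cast_add, add_pow, add_pow, ← Finset.sum_sub_distrib]
    refine Finset.sum_congr rfl fun t _ => ?_
    rw [hg, neg_pow]
    ring
  have h2 : (range ((m - 1) / 2 + 1)).image (fun j => 2 * j + 1) ⊆ range (m + 1) := by
    intro t ht
    simp only [Finset.mem_image, Finset.mem_range] at ht ⊢
    omega
  rw [h1, ← Finset.sum_subset h2, Finset.sum_image (by intro i _ j _ h; simpa using h),
    Nat.cast_sum, Finset.mul_sum]
  · refine Finset.sum_congr rfl fun j _ => ?_
    rw [(odd_two_mul_add_one j).neg_one_pow, hg]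
    push_cast
    rw [Nat.sub_sub]
  · intro t ht hne
    have : Even t := by
      rw [← Nat.not_odd_iff_even]
      rintro ⟨j, rfl⟩
      exact hne (Finset.mem_image.2 ⟨j, by simp at ht ⊢; omega, rfl⟩)
    simp [this.neg_one_pow]

theorem sum_Ico_neg_one_pow {a : ℕ} (hq : Odd q) :
    ∑ d ∈ Finset.Ico a q, (-1 : ℤ) ^ d = ((q - a + 1) / 2 : ℕ) - ((q - a) / 2 : ℕ) := by
  rw [Finset.sum_Ico_eq_sum_range]
  simp_rw [pow_add]
  rw [← Finset.mul_sum, neg_one_geom_sum]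
  split_ifs with h
  · obtain ⟨r, hr⟩ := h
    omega
  · rw [Nat.not_even_iff_odd] at h
    have ha' : Even a := by
      by_contra hodd
      rw [Nat.not_even_iff_odd] at hodd
      exact Nat.not_even_iff_odd.2 h (Nat.Odd.sub_odd hq hodd)
    obtain ⟨r, hr⟩ := h
    rw [ha'.neg_one_pow]
    omega

/-- The number of base-`q` digit vectors with odd digit sum and all digits at least `a`. -/
theorem card_odd_sum_forall_le {a : ℕ} (hq : Odd q) :
    ((univ : Finset (Fin m → Fin q)).filter fun f =>
      Odd (∑ i, (f i : ℕ)) ∧ ∀ i, a ≤ f i).card =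
      ∑ j ∈ range ((m - 1) / 2 + 1), m.choose (2 * j + 1) * ((q - a) / 2) ^ (2 * j + 1) *
        ((q - a + 1) / 2) ^ (m - 2 * j - 1) := by
  set S : Finset (Fin q) := univ.filter fun d => a ≤ (d : ℕ) with hS
  have hmap : S.map Fin.valEmbedding = Finset.Ico a q := by
    ext d
    simp only [hS, Finset.mem_map, Finset.mem_filter, Finset.mem_univ, true_and,
      Fin.valEmbedding_apply, Finset.mem_Ico]
    exact ⟨fun ⟨x, hx, hd⟩ => hd ▸ ⟨hx, x.2⟩, fun h => ⟨⟨d, h.2⟩, h.1, rfl⟩⟩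
  have hcard : S.card = (q - a) / 2 + (q - a + 1) / 2 := by
    rw [← Finset.card_map Fin.valEmbedding, hmap, Nat.card_Ico]
    omega
  have hsum : ∑ d ∈ S, (-1 : ℤ) ^ (d : ℕ) = ((q - a + 1) / 2 : ℕ) - ((q - a) / 2 : ℕ) := by
    rw [← sum_Ico_neg_one_pow hq, ← hmap, Finset.sum_map]
    rfl
  have h := two_mul_card_odd_sum_piFinset (m := m) S
  rw [hsum, hcard, ← two_mul_sum_choose_odd] at h
  have heq : ((univ : Finset (Fin m → Fin q)).filter fun f =>
      Odd (∑ i, (f i : ℕ)) ∧ ∀ i, a ≤ f i) =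
      (Fintype.piFinset fun _ : Fin m => S).filter fun f => Odd (∑ i, (f i : ℕ)) := by
    ext f
    simp [hS, and_comm]
  rw [heq]
  exact_mod_cast mul_left_cancel₀ two_ne_zero h

theorem card_odd_sum_exists_lt_add {a : ℕ} (hq : Odd q) :
    ((univ : Finset (Fin m → Fin q)).filter fun f =>
      Odd (∑ i, (f i : ℕ)) ∧ ∃ i, (f i : ℕ) < a).card +
    ((univ : Finset (Fin m → Fin q)).filter fun f =>
      Odd (∑ i, (f i : ℕ)) ∧ ∀ i, a ≤ f i).card = (q ^ m - 1) / 2 := by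
  have h := two_mul_card_odd_sum_piFinset (m := m) (univ : Finset (Fin q))
  have hsum : ∑ d : Fin q, (-1 : ℤ) ^ (d : ℕ) = 1 := by
    rw [Fin.sum_univ_eq_sum_range (fun d => (-1 : ℤ) ^ d) q, neg_one_geom_sum,
      if_neg (Nat.not_even_iff_odd.2 hq)]
  rw [hsum, one_pow, Finset.card_univ, Fintype.card_fin, Fintype.piFinset_univ,
    ← Finset.card_filter_add_card_filter_not (fun f => ∃ i, (f i : ℕ) < a), Finset.filter_filter,
    Finset.filter_filter] at h
  simp only [not_exists, not_lt] at h
  have h2 := Nat.one_le_pow m q hq.pos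
  rw [← Nat.cast_pow, ← Nat.cast_one (R := ℤ), ← Nat.cast_sub h2] at h
  omega

theorem injOn_natCast_finFunctionFinEquiv (hq : Odd q) :
    Set.InjOn (fun f : Fin m → Fin q => ((finFunctionFinEquiv f : ℕ) : ZMod (q ^ m - 1)))
      {f | Odd (∑ i, (f i : ℕ))} := by
  have hlt : ∀ f : Fin m → Fin q, Odd (∑ i, (f i : ℕ)) →
      (finFunctionFinEquiv f : ℕ) < q ^ m - 1 := by
    intro f hf
    have h1 := (finFunctionFinEquiv f).2
    have h2 := (odd_finFunctionFinEquiv hq f).2 hf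
    have h3 : Even (q ^ m - 1) := Nat.Odd.sub_odd hq.pow odd_one
    have h4 : (finFunctionFinEquiv f : ℕ) ≠ q ^ m - 1 := fun h =>
      Nat.not_even_iff_odd.2 h2 (h ▸ h3)
    omega
  intro f hf g hg h
  have := (ZMod.natCast_eq_natCast_iff' _ _ _).1 h
  rw [Nat.mod_eq_of_lt (hlt f hf), Nat.mod_eq_of_lt (hlt g hg)] at this
  exact finFunctionFinEquiv.injective (Fin.ext this)

theorem natCast_pow_eq_one (hq : 0 < q) : (q : ZMod (q ^ m - 1)) ^ m = 1 := by
  have h : ((q ^ m - 1 : ℕ) : ZMod (q ^ m - 1)) = 0 := ZMod.natCast_self _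
  rw [Nat.cast_sub (Nat.one_le_pow m q hq), sub_eq_zero] at h
  exact_mod_cast h

theorem iUnion_qCoset_eq_image [NeZero m] {a d : ℕ} (hq : Odd q) (ha : a < q)
    (hd : ∀ i, i ≤ d ↔ 1 + 2 * i < a * ∑ i ∈ range m, q ^ i) :
    (⋃ i ∈ Set.Icc 0 d, qCoset q (q ^ m - 1) (1 + 2 * i)) =
      (fun f : Fin m → Fin q => ((finFunctionFinEquiv f : ℕ) : ZMod (q ^ m - 1))) ''
        {f | Odd (∑ i, (f i : ℕ)) ∧ ∃ i, (f i : ℕ) < a} := by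
  have hN := natCast_pow_eq_one (m := m) hq.pos
  have hshift : ∀ (f : Fin m → Fin q) (j : Fin m),
      ∑ i, (f (i - j) : ℕ) = ∑ i, (f i : ℕ) := fun f j =>
    (Equiv.subRight j).sum_comp fun i => (f i : ℕ)
  have hle : a * ∑ i ∈ range m, q ^ i ≤ q ^ m - 1 := by
    rw [← geom_sum_mul_of_one_le (show 1 ≤ q from hq.pos), mul_comm]
    exact Nat.mul_le_mul_left _ (by omega)
  ext x
  simp only [Set.mem_iUnion, Set.mem_Icc, Nat.zero_le, true_and, exists_prop, Set.mem_image,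
    Set.mem_ofPred_eq, qCoset, Set.mem_range]
  constructor
  · rintro ⟨i, hi, j, rfl⟩
    rw [hd] at hi
    obtain ⟨f, hf⟩ := (finFunctionFinEquiv (m := q) (n := m)).surjective ⟨1 + 2 * i, by omega⟩
    have hf' : (finFunctionFinEquiv f : ℕ) = 1 + 2 * i := by rw [hf]
    have hodd : Odd (∑ i, (f i : ℕ)) := by
      rw [← odd_finFunctionFinEquiv hq, hf']
      exact ⟨i, by ring⟩
    let j' : Fin m := ⟨j % m, Nat.mod_lt _ (NeZero.pos m)⟩
    refine ⟨fun i => f (i - j'), ⟨by rwa [hshift], ?_⟩, ?_⟩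
    · by_contra! hall
      have := le_finFunctionFinEquiv (f := f) (a := a) fun i => by simpa using hall (i + j')
      omega
    · rw [natCast_finFunctionFinEquiv_sub hN, hf', pow_eq_pow_mod j hN]
  · rintro ⟨f, ⟨hodd, i, hi⟩, rfl⟩
    let t : Fin m := ⟨m - 1, by have := NeZero.pos m; omega⟩
    have hlt := finFunctionFinEquiv_lt (f := fun k => f (k - (t - i))) (i := t) (a := a)
      (by have := NeZero.pos m; simp only [t]; omega) (by simpa using hi)
    have ho := (odd_finFunctionFinEquiv hq fun k => f (k - (t - i))).2 (by rwa [hshift])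
    obtain ⟨s, hs⟩ := ho
    refine ⟨s, (hd s).2 (by omega), ((i - t : Fin m) : ℕ), ?_⟩
    rw [add_comm 1, ← hs, ← natCast_finFunctionFinEquiv_sub hN]
    simp only [sub_sub]
    congr 4
    funext k
    congr 1
    abel

end Digits

/-- If the base-`q` digit vectors in `B` parametrize the defining set of the negacyclic BCH code,
then the code has dimension `n - #B`. -/
theorem finrank_negaBCH_eq_sub_card {F E : Type*} [Field F] [Fintype F] [Field E] [Algebra F E]
    {n δ m q : ℕ} [NeZero n] {γ : E} (hF : Fintype.card F = q) (hn : 2 * n = q ^ m - 1)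
    (hγ : IsPrimitiveRoot γ (2 * n)) (hq : Odd q) {B : Finset (Fin m → Fin q)}
    (hB : ∀ f ∈ B, Odd (∑ i, (f i : ℕ)))
    (hT : (⋃ i ∈ Set.Icc 0 (δ - 2), qCoset q (q ^ m - 1) (1 + 2 * i)) =
      (fun f : Fin m → Fin q => ((finFunctionFinEquiv f : ℕ) : ZMod (q ^ m - 1))) '' B) :
    Module.finrank F (negaBCH F n γ δ 0) = n - B.card := by
  classical
  have hpow : ∀ s t : ℕ, γ ^ s = γ ^ t ↔ (s : ZMod (q ^ m - 1)) = t := by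
    intro s t
    rw [← hn, ZMod.natCast_eq_natCast_iff, hγ.eq_orderOf, (hγ.isOfFinOrder (NeZero.ne _)).pow_eq_pow_iff_modEq]
  have hmem : ∀ f ∈ B, ∃ i ∈ Set.Icc 0 (δ - 2), ∃ j : ℕ,
      ((1 + 2 * i : ℕ) : ZMod (q ^ m - 1)) * (q : ZMod (q ^ m - 1)) ^ j =
        (finFunctionFinEquiv f : ℕ) := by
    intro f hf
    have := hT.symm ▸ Set.mem_image_of_mem
      (fun f : Fin m → Fin q => ((finFunctionFinEquiv f : ℕ) : ZMod (q ^ m - 1))) hf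
    simpa only [Set.mem_iUnion, exists_prop, qCoset, Set.mem_range] using this
  have hmem' : ∀ i ≤ δ - 2, ∀ j : ℕ, ∃ f ∈ B, ((finFunctionFinEquiv f : ℕ) : ZMod (q ^ m - 1)) =
      ((1 + 2 * i : ℕ) : ZMod (q ^ m - 1)) * (q : ZMod (q ^ m - 1)) ^ j := by
    intro i hi j
    have : ((1 + 2 * i : ℕ) : ZMod (q ^ m - 1)) * (q : ZMod (q ^ m - 1)) ^ j ∈
        ⋃ i ∈ Set.Icc 0 (δ - 2), qCoset q (q ^ m - 1) (1 + 2 * i) :=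
      Set.mem_biUnion (show i ∈ Set.Icc 0 (δ - 2) from ⟨Nat.zero_le _, hi⟩) ⟨j, rfl⟩
    rwa [hT] at this
  have hcard : (B.image fun f => γ ^ (finFunctionFinEquiv f : ℕ)).card = B.card :=
    Finset.card_image_of_injOn fun f hf g hg h =>
      injOn_natCast_finFunctionFinEquiv hq (hB f hf) (hB g hg) ((hpow _ _).1 h)
  rw [← hcard]
  refine finrank_iInf_ker_evalAt n _ _ _ ?_ ?_ ?_
  · intro i hi
    obtain ⟨f, hf, h⟩ := hmem' i (by simp at hi; omega) 0
    exact Finset.mem_image.2 ⟨f, hf, (hpow _ _).2 (by simpa using h)⟩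
  · intro x hx
    obtain ⟨f, hf, rfl⟩ := Finset.mem_image.1 hx
    obtain ⟨i, hi, j, h⟩ := hmem f hf
    obtain ⟨g, hg, h'⟩ := hmem' i hi.2 (j + 1)
    refine Finset.mem_image.2 ⟨g, hg, ?_⟩
    rw [← pow_mul, hpow, h', hF, Nat.cast_mul, ← h, pow_succ, mul_assoc]
  · intro x hx
    obtain ⟨f, hf, rfl⟩ := Finset.mem_image.1 hx
    obtain ⟨i, hi, j, h⟩ := hmem f hf
    refine ⟨i, by simpa using hi.2, j, ?_⟩
    rw [← pow_mul, hpow, hF, ← h, Nat.cast_mul, Nat.cast_pow]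

theorem stmt_0 (q m a n δt δ k : ℕ)
    (hq : ∃ p e : ℕ, p.Prime ∧ Odd p ∧ 0 < e ∧ q = p ^ e)
    (hq3 : 3 < q) (hm : 2 < m)
    (ha1 : 1 ≤ a) (ha2 : 2 * a < q - 1)
    (hn : 2 * n = q ^ m - 1)
    (hδt : δt = a * (q ^ m - 1) / (q - 1))
    (hδ : δ = (δt + 2) / 2)
    (hk : k = ∑ j ∈ Finset.range ((m - 1) / 2 + 1),
      Nat.choose m (2 * j + 1) * ((q - a) / 2) ^ (2 * j + 1) *
        ((q - a + 1) / 2) ^ (m - 2 * j - 1))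
    (F E : Type*) [Field F] [Fintype F] [Field E] [Algebra F E]
    (hF : Fintype.card F = q)
    (γ : E) (hγ : IsPrimitiveRoot γ (2 * n)) :
    (∀ c ∈ negaBCH F n γ δ 0, c ≠ 0 → δ ≤ hWt c) ∧
    Module.finrank F (negaBCH F n γ δ 0) = k ∧
    n - (⋃ i ∈ Set.Icc 0 (δ - 2), qCoset q (2 * n) (1 + 2 * i)).ncard = k := by
  have hqo : Odd q := by
    obtain ⟨p, e, -, hp, -, rfl⟩ := hq
    exact hp.pow
  have : NeZero m := ⟨by omega⟩
  set G := ∑ i ∈ range m, q ^ i with hG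
  have hgeom : G * (q - 1) = q ^ m - 1 := geom_sum_mul_of_one_le hqo.pos m
  have hδG : δt = a * G := by
    rw [hδt, ← hgeom, ← mul_assoc, Nat.mul_div_cancel _ (by omega)]
  have hqG : q ≤ G := by
    simpa using Finset.single_le_sum (f := fun i => q ^ i) (fun _ _ => Nat.zero_le _)
      (Finset.mem_range.2 (show 1 < m by omega))
  have hδt4 : 4 ≤ δt := by
    rw [hδG]
    nlinarith
  have : NeZero n := ⟨by
    rintro rfl
    have : 0 < G * (q - 1) := Nat.mul_pos (by omega) (by omega)
    omega⟩
  set B : Finset (Fin m → Fin q) := univ.filter fun f =>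
    Odd (∑ i, (f i : ℕ)) ∧ ∃ i, (f i : ℕ) < a with hB
  have hcount : n - B.card = k := by
    have h1 := card_odd_sum_exists_lt_add (m := m) (a := a) hqo
    rw [card_odd_sum_forall_le hqo, ← hk, ← hB, ← hn, Nat.mul_div_cancel_left _ two_pos] at h1
    omega
  have hT := iUnion_qCoset_eq_image (m := m) (a := a) (d := δ - 2) hqo (by omega) (by
    intro i
    rw [← hG, ← hδG]
    omega)
  have hBset : {f : Fin m → Fin q | Odd (∑ i, (f i : ℕ)) ∧ ∃ i, (f i : ℕ) < a} = B := by
    ext f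
    simp [hB]
  rw [hBset] at hT
  have hBodd : ∀ f ∈ B, Odd (∑ i, (f i : ℕ)) := fun f hf => (Finset.mem_filter.1 hf).2.1
  refine ⟨fun c hc hc0 => ?_, ?_, ?_⟩
  · have := lt_hWt_of_evalAt_eq_zero (d := δ - 1) hγ hc0 fun i hi => by
      simp only [negaBCH, Submodule.mem_iInf, LinearMap.mem_ker] at hc
      exact hc i (by simp; omega)
    omega
  · rw [← hcount]
    exact finrank_negaBCH_eq_sub_card hF hn hγ hqo hBodd hT
  · rw [hn, hT, Set.InjOn.ncard_image ((injOn_natCast_finFunctionFinEquiv hqo).mono hBodd),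
      Set.ncard_coe_finset, hcount]
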